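/- arXiv:2107.13422 — 4 statements merged into one kernel-verified Lean document; each statement's English description precedes it below -/
import Mathlib

section
/- Let f ∈ C^0(U; (0,∞)) be continuous with respect to the product topology. Then the marginal densities converge uniformly to f: lim_{k→∞} sup_{y∈U} |𝑓̂_k(y_{[k]}) − f(y)| = 0. -/
open MeasureTheory Set Filter Topology

noncomputable section

namespace SparseTransport

/-- The interval `[-1,1]` as a type. -/
abbrev II : Type := Set.Icc (-1 : ℝ) 1
instance : Nonempty II := ⟨⟨0, by norm_num⟩⟩

/-- `U = [-1,1]^ℕ`. -/
abbrev U : Type := ℕ → II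

/-- The uniform probability measure `λ/2` on `[-1,1]`. -/
def muI : Measure II := (2 : ENNReal)⁻¹ • ((volume : Measure ℝ).comap Subtype.val)

/-- The product measure `⊗_{j=1}^k λ/2` on `[-1,1]^k`. -/
def muK (k : ℕ) : Measure (Fin k → II) := Measure.pi fun _ => muI

/-- `μ` is the countable product `⊗_{j∈ℕ} λ/2` on `U`, characterized as the projective
limit of the finite-dimensional products of uniform measures. -/
def IsProductMeasure (μ : Measure U) : Prop :=
  IsProjectiveLimit μ (fun J : Finset ℕ => Measure.pi fun _ : J => muI)

/-- Concatenation `(y_{[k]}, t)` of `y ∈ [-1,1]^k` with `t ∈ U`. -/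
def concat {k : ℕ} (y : Fin k → II) (t : U) : U :=
  fun j => if h : j < k then y ⟨j, h⟩ else t (j - k)

/-- The marginal density `f̂_k(y_{[k]}) = ∫_U f(y_{[k]}, t) dμ(t)`. -/
def marginal (μ : Measure U) (f : U → ℝ) (k : ℕ) (y : Fin k → II) : ℝ :=
  ∫ t, f (concat y t) ∂μ

/-- The conditional density `f_{k+1}(y_{[k+1]}) = f̂_{k+1}(y_{[k+1]}) / f̂_k(y_{[k]})`
(`k+1` is the paper's index `k`). -/
def condDens (μ : Measure U) (f : U → ℝ) (k : ℕ) (y : Fin (k + 1) → II) : ℝ :=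
  marginal μ f (k + 1) y / marginal μ f k (fun j => y j.castSucc)

/-- `F_{k+1}(y_{[k]}, x) = ∫_{-1}^x f_{k+1}(y_{[k]}, t) dμ(t)`, the conditional CDF. -/
def condCDF' (μ : Measure U) (f : U → ℝ) (k : ℕ) (y : Fin k → II) (x : ℝ) : ℝ :=
  ∫ t : II, (if (t : ℝ) ≤ x then condDens μ f k (Fin.snoc y t) else 0) ∂muI

/-- One step of the Knothe–Rosenblatt construction:
`T_{k+1}(y_{[k]}, t) = (x ↦ F_{π,k+1}(T_{[k]}(y_{[k]}), x))^{-1} (F_{ρ,k+1}(y_{[k]}, t))`. -/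
def KRstep (μ : Measure U) (fρ fπ : U → ℝ) (k : ℕ) (yorig ytrans : Fin k → II) (t : II) : II :=
  Function.invFun (fun s : II => condCDF' μ fπ k ytrans (s : ℝ))
    (condCDF' μ fρ k yorig (t : ℝ))

/-- The first `k` components `T_{[k]}` of the KR transport. -/
def KRvec (μ : Measure U) (fρ fπ : U → ℝ) : (k : ℕ) → U → (Fin k → II)
  | 0 => fun _ => Fin.elim0
  | (k + 1) => fun x =>
      Fin.snoc (KRvec μ fρ fπ k x)
        (KRstep μ fρ fπ k (fun j : Fin k => x j) (KRvec μ fρ fπ k x) (x k))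

/-- The `k`-th component of the KR transport (`0`-based: it depends on the
coordinates `0, …, k`). -/
def KRcomp (μ : Measure U) (fρ fπ : U → ℝ) (k : ℕ) (x : U) : II :=
  KRvec μ fρ fπ (k + 1) x (Fin.last k)

/-- The Knothe–Rosenblatt transport `T : U → U` pushing `ρ` forward to `π`. -/
def KRmap (μ : Measure U) (fρ fπ : U → ℝ) (x : U) : U := fun k => KRcomp μ fρ fπ k x

/-- Replace the `k`-th coordinate of `x ∈ U` by (the projection to `[-1,1]` of) `t ∈ ℝ`. -/
def updCoord (x : U) (k : ℕ) (t : ℝ) : U :=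
  Function.update x k (Set.projIcc (-1) 1 (by norm_num) t)

/-- Partial derivative `∂_k g` of `g : U → ℝ` with respect to the `k`-th coordinate
(a derivative within `[-1,1]`). -/
def pderiv (g : U → ℝ) (k : ℕ) (x : U) : ℝ :=
  derivWithin (fun t : ℝ => g (updCoord x k t)) (Set.Icc (-1) 1) ((x k : ℝ))

/-- `∂_k T_k` for the KR transport (0-based components). -/
def pderivKR (μ : Measure U) (fρ fπ : U → ℝ) (k : ℕ) (x : U) : ℝ :=
  pderiv (fun z => (KRcomp μ fρ fπ k z : ℝ)) k x

/-- A positive continuous probability density on `U` with respect to `μ`. -/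
def IsPositiveDensity (μ : Measure U) (f : U → ℝ) : Prop :=
  Continuous f ∧ (∀ x, 0 < f x) ∧ ∫ x, f x ∂μ = 1

instance isProbabilityMeasure_muI : IsProbabilityMeasure muI := by
  constructor
  rw [muI, Measure.smul_apply,
    (MeasurableEmbedding.subtype_coe measurableSet_Icc).comap_apply, image_univ,
    Subtype.range_coe, Real.volume_Icc]
  norm_num
  exact ENNReal.inv_mul_cancel (by norm_num) (by norm_num)

theorem IsProductMeasure.isProbabilityMeasure {μ : Measure U} (hμ : IsProductMeasure μ) :
    IsProbabilityMeasure μ :=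
  IsProjectiveLimit.isProbabilityMeasure hμ

theorem continuous_concat {k : ℕ} (y : Fin k → II) : Continuous (concat y) := by
  refine continuous_pi fun j => ?_
  unfold concat
  split_ifs
  · exact continuous_const
  · exact continuous_apply _

/-- Concatenating the first `k` coordinates of `y` with any tail converges to `y`, uniformly
in `y` and in the tail. -/
theorem tendstoUniformly_concat :
    TendstoUniformly (fun (k : ℕ) (p : U × U) => concat (fun j : Fin k => p.1 j) p.2)
      Prod.fst atTop := by
  rw [tendstoUniformly_iff_tendsto, Pi.uniformity, tendsto_iInf]
  refine fun i => tendsto_comap_iff.2 fun s hs => ?_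
  have hev : ∀ᶠ q : ℕ × U × U in atTop ×ˢ ⊤, i < q.1 :=
    tendsto_fst.eventually (eventually_gt_atTop i)
  refine hev.mono fun q hq => ?_
  simpa [concat, hq] using refl_mem_uniformity hs

/-- Lemma `LEMMA:FC0`, part (3).  If `f : U → (0,∞)` is continuous
with respect to the product topology, then the marginal densities converge uniformly
to `f`: `lim_{k→∞} sup_{y∈U} |f̂_k(y_{[k]}) − f(y)| = 0`. -/
theorem marginal_tendstoUniformly
    (μ : Measure U) (hμ : IsProductMeasure μ)
    (f : U → ℝ) (hf : Continuous f) (hfpos : ∀ x, 0 < f x) :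
    Tendsto (fun k : ℕ => ⨆ y : U, |marginal μ f k (fun j : Fin k => y j) - f y|)
      atTop (𝓝 0) := by
  have := hμ.isProbabilityMeasure
  have hunif := (CompactSpace.uniformContinuous_of_continuous hf).comp_tendstoUniformly
    tendstoUniformly_concat
  rw [Metric.tendstoUniformly_iff] at hunif
  rw [Metric.tendsto_atTop]
  intro ε hε
  obtain ⟨N, hN⟩ := eventually_atTop.1 (hunif (ε / 2) (half_pos hε))
  refine ⟨N, fun k hk => ?_⟩
  have hle : ∀ y : U, |marginal μ f k (fun j : Fin k => y j) - f y| ≤ ε / 2 := fun y => by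
    have hint : Integrable (fun t => f (concat (fun j : Fin k => y j) t)) μ :=
      (hf.comp (continuous_concat _)).integrable_of_hasCompactSupport
        (HasCompactSupport.of_compactSpace _)
    have hsub : marginal μ f k (fun j : Fin k => y j) - f y =
        ∫ t, (f (concat (fun j : Fin k => y j) t) - f y) ∂μ := by
      rw [integral_sub hint (integrable_const _)]
      simp [marginal]
    rw [hsub, ← Real.norm_eq_abs]
    refine (norm_integral_le_of_norm_le_const (C := ε / 2) (ae_of_all _ fun t => ?_)).trans
      (by simp)
    rw [← dist_eq_norm, dist_comm]
    exact (hN k hk (y, t)).le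
  rw [Real.dist_0_eq_abs, abs_of_nonneg (Real.iSup_nonneg fun _ => abs_nonneg _)]
  exact (ciSup_le hle).trans_lt (half_lt_self hε)

end SparseTransport
end
end

section
/- Let (a_j)_{j∈ℕ}, (b_j)_{j∈ℕ} ⊆ (0,∞) be such that lim_{n→∞} Σ_{j=1}^n log(a_j) exists in ℝ and Σ_{j∈ℕ} |a_j − b_j| < ∞. Then a_min := inf_{j∈ℕ} a_j > 0 and b_min := inf_{j∈ℕ} b_j > 0, the limit lim_{n→∞} ∏_{j=1}^n b_j exists in ℝ, and |lim_{n→∞} ∏_{j=1}^n a_j − lim_{n→∞} ∏_{j=1}^n b_j| ≤ C · Σ_{j∈ℕ} |a_j − b_j|, where C := exp(Σ_{j∈ℕ} |a_j − b_j| / a_min) · (lim_{n→∞} ∏_{j=1}^n a_j) / min{a_min, b_min} < ∞. -/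
open Filter Topology Finset

theorem iInf_pos_of_tendsto_pos {a : ℕ → ℝ} {c : ℝ} (ha : ∀ j, 0 < a j) (hc : 0 < c)
    (h : Tendsto a atTop (𝓝 c)) : 0 < ⨅ j : ℕ, a j := by
  obtain ⟨N, hN⟩ := eventually_atTop.1 (h.eventually (lt_mem_nhds (half_lt_self hc)))
  obtain ⟨k, -, hk⟩ := (Finset.range (N + 1)).exists_min_image a ⟨0, by simp⟩
  refine lt_of_lt_of_le (lt_min (half_pos hc) (ha k)) (le_ciInf fun j => ?_)
  rcases le_total N j with hj | hj
  · exact (min_le_left _ _).trans (hN j hj).le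
  · exact (min_le_right _ _).trans (hk j (by simp; omega))

theorem log_sub_log_le_abs_sub_div {x y m : ℝ} (hx : 0 < x) (hy : 0 < y) (hm : 0 < m)
    (hmx : m ≤ x) : Real.log y - Real.log x ≤ |x - y| / m := by
  have h := Real.log_le_sub_one_of_pos (div_pos hy hx)
  rw [Real.log_div hy.ne' hx.ne', div_sub_one hx.ne'] at h
  calc Real.log y - Real.log x ≤ (y - x) / x := h
    _ ≤ |x - y| / x := by
      gcongr
      rw [abs_sub_comm]
      exact le_abs_self _
    _ ≤ |x - y| / m := by gcongr

theorem abs_one_sub_exp_le {L s t : ℝ} (hs : 0 ≤ s) (hL : L ≤ s) (ht : |L| ≤ t) :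
    |1 - Real.exp L| ≤ Real.exp s * t := by
  obtain ⟨h1, h2⟩ := abs_le.1 ht
  have hes : 1 ≤ Real.exp s := Real.one_le_exp hs
  have ht0 : 0 ≤ t := (abs_nonneg L).trans ht
  have hLs : Real.exp L ≤ Real.exp s := Real.exp_le_exp.2 hL
  refine abs_le.2 ⟨?_, ?_⟩
  · have h := Real.add_one_le_exp (-L)
    have hmul : Real.exp L * Real.exp (-L) = 1 := by rw [← Real.exp_add]; simp
    have h3 : Real.exp L - 1 ≤ Real.exp L * L := by
      nlinarith [mul_le_mul_of_nonneg_left h (Real.exp_pos L).le]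
    have h4 : Real.exp L * L ≤ Real.exp s * t :=
      (mul_le_mul_of_nonneg_left h2 (Real.exp_pos L).le).trans
        (mul_le_mul_of_nonneg_right hLs ht0)
    linarith
  · nlinarith [Real.add_one_le_exp L]

/-- Lemma `LEMMA:DET`.  Let `(a_j), (b_j) ⊆ (0,∞)` be such that
`lim_n ∑_{j<n} log a_j` exists in `ℝ` and `∑_j |a_j − b_j| < ∞`.  Then
`a_min := inf_j a_j > 0`, `b_min := inf_j b_j > 0`, the limit `lim_n ∏_{j<n} b_j`
exists in `ℝ`, and `|lim ∏ a_j − lim ∏ b_j| ≤ C ∑_j |a_j − b_j|` where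
`C = exp(∑_j |a_j − b_j| / a_min) · (lim ∏ a_j) / min(a_min, b_min)`. -/
theorem prod_limit_perturbation
    (a b : ℕ → ℝ) (ha : ∀ j, 0 < a j) (hb : ∀ j, 0 < b j)
    (Pa : ℝ)
    (hlog : ∃ La : ℝ,
      Tendsto (fun n : ℕ => ∑ j ∈ Finset.range n, Real.log (a j)) atTop (𝓝 La))
    (hPa : Tendsto (fun n : ℕ => ∏ j ∈ Finset.range n, a j) atTop (𝓝 Pa))
    (hdiff : Summable fun j => |a j - b j|) :
    (0 < ⨅ j : ℕ, a j) ∧ (0 < ⨅ j : ℕ, b j) ∧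
    ∃ Pb : ℝ,
      Tendsto (fun n : ℕ => ∏ j ∈ Finset.range n, b j) atTop (𝓝 Pb) ∧
      |Pa - Pb| ≤
        (Real.exp ((∑' j : ℕ, |a j - b j|) / ⨅ j : ℕ, a j) * Pa /
            min (⨅ j : ℕ, a j) (⨅ j : ℕ, b j)) *
          ∑' j : ℕ, |a j - b j| := by
  obtain ⟨La, hLa⟩ := hlog
  have hloga : Tendsto (fun n => Real.log (a n)) atTop (𝓝 0) := by
    simpa [Finset.sum_range_succ] using (hLa.comp (tendsto_add_atTop_nat 1)).sub hLa
  have hatend : Tendsto a atTop (𝓝 1) := by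
    simpa [Function.comp_def, Real.exp_log (ha _)] using
      (Real.continuous_exp.tendsto 0).comp hloga
  have hbtend : Tendsto b atTop (𝓝 1) := by
    have hsub : Tendsto (fun j => a j - b j) atTop (𝓝 0) :=
      (tendsto_zero_iff_abs_tendsto_zero _).2 hdiff.tendsto_atTop_zero
    simpa using hatend.sub hsub
  have hma := iInf_pos_of_tendsto_pos ha one_pos hatend
  have hmb := iInf_pos_of_tendsto_pos hb one_pos hbtend
  have hale : ∀ j, (⨅ j, a j) ≤ a j :=
    ciInf_le ⟨0, Set.forall_mem_range.2 fun j => (ha j).le⟩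
  have hble : ∀ j, (⨅ j, b j) ≤ b j :=
    ciInf_le ⟨0, Set.forall_mem_range.2 fun j => (hb j).le⟩
  refine ⟨hma, hmb, ?_⟩
  set ma := ⨅ j, a j
  set mb := ⨅ j, b j
  set S := ∑' j, |a j - b j| with hS
  have hM : 0 < min ma mb := lt_min hma hmb
  have hbound : ∀ j, ‖Real.log (b j) - Real.log (a j)‖ ≤ |a j - b j| / min ma mb := by
    intro j
    rw [Real.norm_eq_abs]
    refine abs_sub_le_iff.2 ⟨?_, ?_⟩
    · exact log_sub_log_le_abs_sub_div (ha j) (hb j) hM ((min_le_left _ _).trans (hale j))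
    · rw [abs_sub_comm (a j)]
      exact log_sub_log_le_abs_sub_div (hb j) (ha j) hM ((min_le_right _ _).trans (hble j))
  have hsum : Summable fun j => Real.log (b j) - Real.log (a j) :=
    (hdiff.div_const _).of_norm_bounded hbound
  set L := ∑' j, (Real.log (b j) - Real.log (a j)) with hL
  have hLM : |L| ≤ S / min ma mb := by
    rw [hS, ← tsum_div_const]
    exact tsum_of_norm_bounded (hdiff.div_const _).hasSum hbound
  have hLa' : L ≤ S / ma := by
    rw [hS, ← tsum_div_const]
    exact hsum.tsum_le_tsum
      (fun j => log_sub_log_le_abs_sub_div (ha j) (hb j) hma (hale j)) (hdiff.div_const _)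
  have hS0 : 0 ≤ S := tsum_nonneg fun j => abs_nonneg _
  have hPa0 : 0 ≤ Pa := ge_of_tendsto' hPa fun n => Finset.prod_nonneg fun j _ => (ha j).le
  refine ⟨Pa * Real.exp L, ?_, ?_⟩
  · refine (hPa.mul ((Real.continuous_exp.tendsto L).comp
      hsum.hasSum.tendsto_sum_nat)).congr fun n => ?_
    simp only [Function.comp_apply]
    rw [Real.exp_sum, ← Finset.prod_mul_distrib]
    refine Finset.prod_congr rfl fun j _ => ?_
    rw [Real.exp_sub, Real.exp_log (ha j), Real.exp_log (hb j),
      mul_div_cancel₀ _ (ha j).ne']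
  · calc |Pa - Pa * Real.exp L| = Pa * |1 - Real.exp L| := by
          rw [← mul_one_sub, abs_mul, abs_of_nonneg hPa0]
      _ ≤ Pa * (Real.exp (S / ma) * (S / min ma mb)) :=
          mul_le_mul_of_nonneg_left
            (abs_one_sub_exp_le (div_nonneg hS0 hma.le) hLa' hLM) hPa0
      _ = Real.exp (S / ma) * Pa / min ma mb * S := by ring
end

section
/- Let τ > 0 and let ϱ ∈ (1,∞)^ℕ be such that (ϱ_j^{−1})_{j∈ℕ} ∈ ℓ^p(ℕ) for some p ∈ (0,1] and sup_{j∈ℕ} ϱ_j^{−1} < 1. Then Σ_{k∈ℕ} Σ_{ν∈ℕ₀^k} γ(ϱ,ν)^p ∏_{j=1}^k (1+2ν_j)^τ < ∞ (a countable sum of nonnegative terms). -/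
open Finset

noncomputable section

namespace SparseTransport

/-- `γ(ϱ, ν) = ϱ_k^{-max(1,ν_k)} ∏_{j<k} ϱ_j^{-ν_j}` for `ν ∈ ℕ₀^{k+1}`
(0-based indexing: `ν` has `k+1` entries and the distinguished index is the last). -/
def gamma (ϱ : ℕ → ℝ) {k : ℕ} (ν : Fin (k + 1) → ℕ) : ℝ :=
  (ϱ k)⁻¹ ^ (max 1 (ν (Fin.last k))) * ∏ j : Fin k, (ϱ j)⁻¹ ^ (ν j.castSucc)

/-- A nonnegative family over a sigma type is summable if its finite partial sums over each fibre
are bounded by a summable family. -/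
theorem summable_sigma_of_sum_le {κ : Type*} {α : κ → Type*} {f : (Σ k, α k) → ℝ} {c : κ → ℝ}
    (hf : ∀ q, 0 ≤ f q) (hc : Summable c)
    (h : ∀ k (u : Finset (α k)), ∑ x ∈ u, f ⟨k, x⟩ ≤ c k) : Summable f :=
  (summable_sigma_of_nonneg hf).2
    ⟨fun k => summable_of_sum_le (fun _ => hf _) (h k),
      hc.of_nonneg_of_le (fun _ => tsum_nonneg fun _ => hf _)
        fun k => Real.tsum_le_of_sum_le (fun _ => hf _) (h k)⟩

/-- If the finite partial sums of each nonnegative `f i` are at most `B i`, then the finite partial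
sums of `x ↦ ∏ i, f i (x i)` are at most `∏ i, B i`. -/
theorem sum_prod_le_prod_of_sum_le {ι α : Type*} [Fintype ι] (f : ι → α → ℝ) (B : ι → ℝ)
    (hf : ∀ i a, 0 ≤ f i a) (hB : ∀ i (s : Finset α), ∑ a ∈ s, f i a ≤ B i)
    (u : Finset (ι → α)) : ∑ x ∈ u, ∏ i, f i (x i) ≤ ∏ i, B i := by
  classical
  calc ∑ x ∈ u, ∏ i, f i (x i)
      ≤ ∑ x ∈ Fintype.piFinset fun i => u.image fun x => x i, ∏ i, f i (x i) := by
        refine Finset.sum_le_sum_of_subset_of_nonneg (fun x hx => ?_)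
          fun x _ _ => Finset.prod_nonneg fun i _ => hf i _
        exact Fintype.mem_piFinset.2 fun i => Finset.mem_image_of_mem (fun x : ι → α => x i) hx
    _ = ∏ i, ∑ a ∈ u.image fun x => x i, f i a := (Finset.prod_univ_sum _ _).symm
    _ ≤ ∏ i, B i :=
        Finset.prod_le_prod (fun i _ => Finset.sum_nonneg fun a _ => hf i a) fun i _ => hB i _

theorem summable_geometric_mul_rpow {r : ℝ} (hr0 : 0 < r) (hr1 : r < 1) (τ : ℝ) :
    Summable fun n : ℕ => r ^ n * (3 + 2 * (n : ℝ)) ^ τ := by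
  obtain ⟨m, hm⟩ := exists_nat_ge τ
  have h := (((summable_nat_add_iff 1).2 (summable_pow_mul_geometric_of_norm_lt_one m
    (r := r) (by rwa [Real.norm_of_nonneg hr0.le]))).mul_left (3 ^ m * r⁻¹))
  refine h.of_nonneg_of_le (fun n => by positivity) fun n => ?_
  have hn : (0 : ℝ) ≤ n := n.cast_nonneg
  calc r ^ n * (3 + 2 * (n : ℝ)) ^ τ ≤ r ^ n * (3 * ((n + 1 : ℕ) : ℝ)) ^ m := by
        gcongr
        calc (3 + 2 * (n : ℝ)) ^ τ ≤ (3 + 2 * (n : ℝ)) ^ (m : ℝ) :=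
              Real.rpow_le_rpow_of_exponent_le (by linarith) hm
          _ = (3 + 2 * (n : ℝ)) ^ m := Real.rpow_natCast _ _
          _ ≤ (3 * ((n + 1 : ℕ) : ℝ)) ^ m := by
              gcongr
              push_cast
              linarith
    _ = _ := by
        rw [mul_pow, pow_succ]
        field_simp

theorem sum_range_geometric_mul_rpow_le {a r : ℝ} (ha : 0 ≤ a) (har : a ≤ r) (hr : r < 1)
    (hr0 : 0 < r) (τ : ℝ) (N : ℕ) :
    ∑ n ∈ range N, a ^ (n + 1) * (1 + 2 * ((n + 1 : ℕ) : ℝ)) ^ τ ≤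
      (∑' n : ℕ, r ^ n * (3 + 2 * (n : ℝ)) ^ τ) * a := by
  calc ∑ n ∈ range N, a ^ (n + 1) * (1 + 2 * ((n + 1 : ℕ) : ℝ)) ^ τ
      ≤ ∑ n ∈ range N, r ^ n * (3 + 2 * (n : ℝ)) ^ τ * a := by
        refine Finset.sum_le_sum fun n _ => ?_
        rw [show (1 : ℝ) + 2 * ((n + 1 : ℕ) : ℝ) = 3 + 2 * n by push_cast; ring, pow_succ,
          mul_right_comm]
        gcongr
    _ ≤ _ := by
        rw [← Finset.sum_mul]
        gcongr
        exact (summable_geometric_mul_rpow hr0 hr τ).sum_le_tsum _ fun n _ => by positivity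

theorem sum_geometric_mul_rpow_le {a r : ℝ} (ha : 0 ≤ a) (har : a ≤ r) (hr : r < 1)
    (hr0 : 0 < r) (τ : ℝ) (s : Finset ℕ) :
    ∑ n ∈ s, a ^ n * (1 + 2 * (n : ℝ)) ^ τ ≤
      1 + (∑' n : ℕ, r ^ n * (3 + 2 * (n : ℝ)) ^ τ) * a := by
  obtain ⟨N, hN⟩ := s.exists_nat_subset_range
  calc ∑ n ∈ s, a ^ n * (1 + 2 * (n : ℝ)) ^ τ
      ≤ ∑ n ∈ range (N + 1), a ^ n * (1 + 2 * (n : ℝ)) ^ τ :=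
        Finset.sum_le_sum_of_subset_of_nonneg
          (hN.trans (Finset.range_subset_range.2 N.le_succ)) fun n _ _ => by positivity
    _ ≤ _ := by
        rw [Finset.sum_range_succ', add_comm]
        have := sum_range_geometric_mul_rpow_le ha har hr hr0 τ N
        simpa using this

theorem sum_pow_max_one_mul_rpow_le {a r : ℝ} (ha : 0 ≤ a) (har : a ≤ r) (hr : r < 1)
    (hr0 : 0 < r) (τ : ℝ) (s : Finset ℕ) :
    ∑ n ∈ s, a ^ max 1 n * (1 + 2 * (n : ℝ)) ^ τ ≤
      (1 + ∑' n : ℕ, r ^ n * (3 + 2 * (n : ℝ)) ^ τ) * a := by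
  obtain ⟨N, hN⟩ := s.exists_nat_subset_range
  calc ∑ n ∈ s, a ^ max 1 n * (1 + 2 * (n : ℝ)) ^ τ
      ≤ ∑ n ∈ range (N + 1), a ^ max 1 n * (1 + 2 * (n : ℝ)) ^ τ :=
        Finset.sum_le_sum_of_subset_of_nonneg
          (hN.trans (Finset.range_subset_range.2 N.le_succ)) fun n _ _ => by positivity
    _ ≤ _ := by
        rw [Finset.sum_range_succ', add_comm, add_mul]
        have := sum_range_geometric_mul_rpow_le ha har hr hr0 τ N
        simpa using this

theorem gamma_rpow_mul_prod_eq (ϱ : ℕ → ℝ) (hϱ : ∀ j, 0 ≤ ϱ j) (p τ : ℝ) {k : ℕ}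
    (ν : Fin (k + 1) → ℕ) :
    gamma ϱ ν ^ p * ∏ j, ((1 : ℝ) + 2 * (ν j : ℝ)) ^ τ =
      ∏ j : Fin (k + 1), ((ϱ j)⁻¹ ^ p) ^ (if j = Fin.last k then max 1 (ν j) else ν j) *
        (1 + 2 * (ν j : ℝ)) ^ τ := by
  have hpos (j : ℕ) : 0 ≤ (ϱ j)⁻¹ := inv_nonneg.2 (hϱ j)
  rw [Finset.prod_mul_distrib]
  congr 1
  rw [gamma, Real.mul_rpow (pow_nonneg (hpos _) _)
    (Finset.prod_nonneg fun j _ => pow_nonneg (hpos _) _),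
    ← Real.finsetProd_rpow _ _ fun j _ => pow_nonneg (hpos _) _, Fin.prod_univ_castSucc, mul_comm]
  simp [Real.rpow_pow_comm (hpos _), Fin.castSucc_ne_last]

theorem sum_gamma_rpow_mul_prod_le {ϱ : ℕ → ℝ} (hϱ : ∀ j, 0 ≤ ϱ j) {p r : ℝ} (τ : ℝ)
    (har : ∀ j, (ϱ j)⁻¹ ^ p ≤ r) (hr0 : 0 < r) (hr1 : r < 1)
    (hlp : Summable fun j => (ϱ j)⁻¹ ^ p) {C : ℝ}
    (hC : C = ∑' n : ℕ, r ^ n * (3 + 2 * (n : ℝ)) ^ τ) (k : ℕ) (u : Finset (Fin (k + 1) → ℕ)) :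
    ∑ ν ∈ u, gamma ϱ ν ^ p * ∏ j, ((1 : ℝ) + 2 * (ν j : ℝ)) ^ τ ≤
      Real.exp (C * ∑' j, (ϱ j)⁻¹ ^ p) * (1 + C) * (ϱ k)⁻¹ ^ p := by
  have hC0 : 0 ≤ C := hC ▸ tsum_nonneg fun n => by positivity
  simp_rw [gamma_rpow_mul_prod_eq ϱ hϱ]
  have ha0 (j : ℕ) : 0 ≤ (ϱ j)⁻¹ ^ p := Real.rpow_nonneg (inv_nonneg.2 (hϱ j)) p
  refine (sum_prod_le_prod_of_sum_le
    (fun (j : Fin (k + 1)) (n : ℕ) => ((ϱ j)⁻¹ ^ p) ^ (if j = Fin.last k then max 1 n else n) *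
      (1 + 2 * (n : ℝ)) ^ τ)
    (fun j => if j = Fin.last k then (1 + C) * (ϱ j)⁻¹ ^ p else 1 + C * (ϱ j)⁻¹ ^ p)
    (fun j n => mul_nonneg (pow_nonneg (ha0 j) _) (by positivity)) (fun j s => ?_) u).trans ?_
  · subst hC
    split_ifs
    · exact sum_pow_max_one_mul_rpow_le (ha0 j) (har j) hr1 hr0 τ s
    · exact sum_geometric_mul_rpow_le (ha0 j) (har j) hr1 hr0 τ s
  · rw [Fin.prod_univ_castSucc]
    simp only [Fin.castSucc_ne_last, if_false, if_true, Fin.val_castSucc, Fin.val_last]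
    rw [← mul_assoc]
    have hk := ha0 k
    gcongr
    calc ∏ j : Fin k, (1 + C * (ϱ j)⁻¹ ^ p) ≤ ∏ j : Fin k, Real.exp (C * (ϱ j)⁻¹ ^ p) :=
          Finset.prod_le_prod (fun j _ => add_nonneg zero_le_one (mul_nonneg hC0 (ha0 j)))
            fun j _ => by linarith [Real.add_one_le_exp (C * (ϱ j)⁻¹ ^ p)]
      _ = Real.exp (C * ∑ j ∈ range k, (ϱ j)⁻¹ ^ p) := by
          rw [← Real.exp_sum, ← Finset.mul_sum, Finset.sum_range]
      _ ≤ Real.exp (C * ∑' j, (ϱ j)⁻¹ ^ p) := by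
          gcongr
          exact hlp.sum_le_tsum _ fun j _ => ha0 j

/-- Lemma `lemma:Sxi0`.  Let `τ > 0` and `ϱ ∈ (1,∞)^ℕ` with
`(ϱ_j^{-1}) ∈ ℓ^p(ℕ)` for some `p ∈ (0,1]` and `sup_j ϱ_j^{-1} < 1`.  Then
`∑_{k∈ℕ} ∑_{ν∈ℕ₀^k} γ(ϱ,ν)^p ∏_{j=1}^k (1+2ν_j)^τ < ∞`. -/
theorem summable_gamma_pow
    (τ : ℝ) (hτ : 0 < τ) (ϱ : ℕ → ℝ) (hϱ : ∀ j, 1 < ϱ j)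
    (p : ℝ) (hp0 : 0 < p) (hp1 : p ≤ 1)
    (hlp : Summable fun j => ((ϱ j)⁻¹) ^ p)
    (hsup : (⨆ j : ℕ, (ϱ j)⁻¹) < 1) :
    Summable fun q : Σ k : ℕ, (Fin (k + 1) → ℕ) =>
      (gamma ϱ q.2) ^ p * ∏ j, ((1 : ℝ) + 2 * (q.2 j : ℝ)) ^ τ := by
  have hpos (j : ℕ) : 0 < (ϱ j)⁻¹ := inv_pos.2 (zero_lt_one.trans (hϱ j))
  have hbdd : BddAbove (Set.range fun j => (ϱ j)⁻¹) :=
    ⟨1, Set.forall_mem_range.2 fun j => inv_le_one_of_one_le₀ (hϱ j).le⟩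
  have hsup0 : 0 < ⨆ j, (ϱ j)⁻¹ := (hpos 0).trans_le (le_ciSup hbdd 0)
  let r : ℝ := (⨆ j, (ϱ j)⁻¹) ^ p
  have hr0 : 0 < r := Real.rpow_pos_of_pos hsup0 p
  have hr1 : r < 1 := Real.rpow_lt_one hsup0.le hsup hp0
  have har (j : ℕ) : (ϱ j)⁻¹ ^ p ≤ r := Real.rpow_le_rpow (hpos j).le (le_ciSup hbdd j) hp0.le
  have hϱ0 (j : ℕ) : 0 ≤ ϱ j := (zero_lt_one.trans (hϱ j)).le
  refine summable_sigma_of_sum_le (fun q => ?_) (hlp.mul_left _)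
    (sum_gamma_rpow_mul_prod_le hϱ0 τ har hr0 hr1 hlp rfl)
  rw [gamma_rpow_mul_prod_eq ϱ hϱ0]
  exact Finset.prod_nonneg fun j _ => mul_nonneg
    (pow_nonneg (Real.rpow_nonneg (hpos j).le p) _) (by positivity)

end SparseTransport
end
end

section
/- Let τ > 0 and let ϱ ∈ (1,∞)^ℕ be such that (ϱ_j^{−1})_{j∈ℕ} ∈ ℓ^p(ℕ) for some p ∈ (0,1] and Σ_{j∈ℕ} ϱ_j^{−1} < 1. Then Σ_{k∈ℕ} Σ_{ν∈ℕ₀^k} ((|ν|^{|ν|} / ν^ν) · γ(ϱ,ν))^p ∏_{j=1}^k (1+2ν_j)^τ < ∞, where |ν| := Σ_{j=1}^k ν_j and ν^ν := ∏_{j : ν_j ≠ 0} ν_j^{ν_j} (with the conventions 0^0 = 1 and empty products equal to 1). -/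
open Finset

noncomputable section

namespace SparseTransport

/-- The combinatorial factor `|ν|^{|ν|} / ν^ν` (with `0^0 = 1`). -/
def combFactor {k : ℕ} (ν : Fin k → ℕ) : ℝ :=
  ((∑ j, ν j : ℕ) : ℝ) ^ (∑ j, ν j : ℕ) / ∏ j, ((ν j : ℝ) ^ (ν j))

/-- `|ν|^{|ν|} / ν^ν` for multi-indices over an arbitrary finite index type. -/
def selfPowCoeff {ι : Type*} [Fintype ι] (ν : ι → ℕ) : ℝ :=
  ((∑ j, ν j : ℕ) : ℝ) ^ (∑ j, ν j : ℕ) / ∏ j, ((ν j : ℝ) ^ (ν j))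

/-- `((|ν|^{|ν|} / ν^ν) a^ν)^p ∏ (1 + 2 ν_j)^τ`. -/
def weightedTerm {ι : Type*} [Fintype ι] (τ p : ℝ) (a : ι → ℝ) (ν : ι → ℕ) : ℝ :=
  (selfPowCoeff ν * ∏ j, a j ^ ν j) ^ p * ∏ j, ((1 : ℝ) + 2 * (ν j : ℝ)) ^ τ

lemma natCast_self_pow_pos (m : ℕ) : (0 : ℝ) < (m : ℝ) ^ m := by
  exact_mod_cast Nat.pow_self_pos

lemma prod_self_pow_pos {ι : Type*} [Fintype ι] (ν : ι → ℕ) :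
    0 < ∏ j, ((ν j : ℝ) ^ (ν j)) :=
  Finset.prod_pos fun _ _ => natCast_self_pow_pos _

lemma selfPowCoeff_nonneg {ι : Type*} [Fintype ι] (ν : ι → ℕ) : 0 ≤ selfPowCoeff ν :=
  div_nonneg (by positivity) (prod_self_pow_pos ν).le

lemma weightedTerm_nonneg {ι : Type*} [Fintype ι] (τ p : ℝ) {a : ι → ℝ} (ha : ∀ i, 0 ≤ a i)
    (ν : ι → ℕ) : 0 ≤ weightedTerm τ p a ν := by
  have := selfPowCoeff_nonneg ν
  have : 0 ≤ ∏ j, a j ^ ν j := Finset.prod_nonneg fun i _ => pow_nonneg (ha i) _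
  unfold weightedTerm
  positivity

/-- Weighted AM-GM for integer weights. -/
lemma sum_pow_sum_mul_prod_le {ι : Type*} [Fintype ι] {b : ι → ℝ} (hb : ∀ i, 0 ≤ b i) (ν : ι → ℕ) :
    ((∑ j, ν j : ℕ) : ℝ) ^ (∑ j, ν j : ℕ) * ∏ j, b j ^ ν j
      ≤ (∑ j, b j) ^ (∑ j, ν j) * ∏ j, ((ν j : ℝ) ^ (ν j)) := by
  rcases Nat.eq_zero_or_pos (∑ j, ν j) with h0 | hpos
  · have h : ∀ i, ν i = 0 := by simpa using h0
    simp [h]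
  set n := ∑ j, ν j with hn
  have hnR : (0 : ℝ) < n := by exact_mod_cast hpos
  have hcast : ∑ j, (ν j : ℝ) = n := by rw [hn]; push_cast; rfl
  have hz : ∀ i, 0 ≤ b i / (ν i : ℝ) := fun i => div_nonneg (hb i) (Nat.cast_nonneg _)
  have key := Real.geom_mean_le_arith_mean Finset.univ (fun i => (ν i : ℝ))
    (fun i => b i / (ν i : ℝ)) (fun i _ => Nat.cast_nonneg _) (by rw [hcast]; exact hnR)
    (fun i _ => hz i)
  simp only [Real.rpow_natCast] at key
  rw [hcast] at key
  have hP : 0 ≤ ∏ i, (b i / (ν i : ℝ)) ^ ν i :=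
    Finset.prod_nonneg fun i _ => pow_nonneg (hz i) _
  have hS : (∑ i, (ν i : ℝ) * (b i / ν i)) ≤ ∑ i, b i := by
    refine Finset.sum_le_sum fun i _ => ?_
    rcases Nat.eq_zero_or_pos (ν i) with h | h
    · simp [h, hb i]
    · have : (ν i : ℝ) ≠ 0 := by positivity
      rw [mul_div_cancel₀ _ this]
  have key2 : ∏ i, (b i / (ν i : ℝ)) ^ ν i ≤ ((∑ i, b i) / n) ^ n := by
    have := pow_le_pow_left₀ (by positivity) (key.trans (div_le_div_of_nonneg_right hS hnR.le)) n
    rwa [Real.rpow_inv_natCast_pow hP hpos.ne'] at this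
  simp only [div_pow, Finset.prod_div_distrib] at key2
  rw [div_le_div_iff₀ (prod_self_pow_pos ν) (by positivity)] at key2
  linarith

lemma selfPowCoeff_mul_prod_le {ι : Type*} [Fintype ι] {b : ι → ℝ} (hb : ∀ i, 0 ≤ b i)
    (ν : ι → ℕ) : selfPowCoeff ν * ∏ j, b j ^ ν j ≤ (∑ j, b j) ^ (∑ j, ν j) := by
  unfold selfPowCoeff
  rw [div_mul_eq_mul_div, div_le_iff₀ (prod_self_pow_pos ν)]
  exact sum_pow_sum_mul_prod_le hb ν

lemma add_pow_mul_le {s t : ℝ} (hs : 0 ≤ s) (ht : 0 ≤ t) (hst : s + t = 1) (m l : ℕ) :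
    ((m + l : ℕ) : ℝ) ^ (m + l) * (s ^ m * t ^ l) ≤ (m : ℝ) ^ m * (l : ℝ) ^ l := by
  have := sum_pow_sum_mul_prod_le (b := ![s, t])
    (by intro i; fin_cases i <;> simpa) ![m, l]
  simpa [Fin.sum_univ_two, Fin.prod_univ_two, hst] using this

lemma weightedTerm_le_mul {ι : Type*} [Fintype ι] (q : ι → Prop) [DecidablePred q] {τ p : ℝ}
    (hp : 0 ≤ p) {a : ι → ℝ} (ha : ∀ i, 0 ≤ a i) {s t : ℝ} (hs : 0 < s) (ht : 0 < t)
    (hst : s + t = 1) (ν : ι → ℕ) :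
    weightedTerm τ p a ν ≤ weightedTerm τ p (fun i : {i // q i} => a i / s) (fun i => ν i) *
      weightedTerm τ p (fun i : {i // ¬ q i} => a i / t) (fun i => ν i) := by
  have hA : 0 ≤ ∏ i : {i // q i}, a i ^ ν i := Finset.prod_nonneg fun i _ => pow_nonneg (ha i) _
  have hB : 0 ≤ ∏ i : {i // ¬ q i}, a i ^ ν i :=
    Finset.prod_nonneg fun i _ => pow_nonneg (ha i) _
  have hD := prod_self_pow_pos fun i : {i // q i} => ν i
  have hE := prod_self_pow_pos fun i : {i // ¬ q i} => ν i
  have hC := selfPowCoeff_nonneg ν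
  have hC1 := selfPowCoeff_nonneg fun i : {i // q i} => ν i
  have hC2 := selfPowCoeff_nonneg fun i : {i // ¬ q i} => ν i
  have key : selfPowCoeff ν * ∏ j, a j ^ ν j ≤
      (selfPowCoeff (fun i : {i // q i} => ν i) * ∏ i : {i // q i}, (a i / s) ^ ν i) *
      (selfPowCoeff (fun i : {i // ¬ q i} => ν i) * ∏ i : {i // ¬ q i}, (a i / t) ^ ν i) := by
    have h := add_pow_mul_le hs.le ht.le hst (∑ i : {i // q i}, ν i) (∑ i : {i // ¬ q i}, ν i)
    simp only [div_pow, Finset.prod_div_distrib, Finset.prod_pow_eq_pow_sum]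
    unfold selfPowCoeff
    rw [← Fintype.sum_subtype_add_sum_subtype q ν,
      ← Fintype.prod_subtype_mul_prod_subtype q fun i => (ν i : ℝ) ^ ν i,
      ← Fintype.prod_subtype_mul_prod_subtype q fun i => a i ^ ν i]
    generalize (∑ i : {i // q i}, ν i) = m at *
    generalize (∑ i : {i // ¬ q i}, ν i) = l at *
    generalize (∏ i : {i // q i}, a i ^ ν i) = A at *
    generalize (∏ i : {i // ¬ q i}, a i ^ ν i) = B at *
    generalize (∏ i : {i // q i}, (ν i : ℝ) ^ ν i) = D at *
    generalize (∏ i : {i // ¬ q i}, (ν i : ℝ) ^ ν i) = E at *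
    rw [← le_div_iff₀ (by positivity)] at h
    calc _ ≤ ((m : ℝ) ^ m * (l : ℝ) ^ l / (s ^ m * t ^ l)) / (D * E) * (A * B) := by gcongr
      _ = _ := by field_simp
  have hA' : 0 ≤ ∏ i : {i // q i}, (a i / s) ^ ν i :=
    Finset.prod_nonneg fun i _ => pow_nonneg (div_nonneg (ha i) hs.le) _
  have hB' : 0 ≤ ∏ i : {i // ¬ q i}, (a i / t) ^ ν i :=
    Finset.prod_nonneg fun i _ => pow_nonneg (div_nonneg (ha i) ht.le) _
  have hA'' : 0 ≤ ∏ j, a j ^ ν j := Finset.prod_nonneg fun i _ => pow_nonneg (ha i) _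
  have h := Real.rpow_le_rpow (by positivity) key hp
  rw [Real.mul_rpow (mul_nonneg hC1 hA') (mul_nonneg hC2 hB')] at h
  unfold weightedTerm
  rw [← Fintype.prod_subtype_mul_prod_subtype q fun i => ((1 : ℝ) + 2 * (ν i : ℝ)) ^ τ]
  rw [mul_mul_mul_comm]
  exact mul_le_mul_of_nonneg_right h (by positivity)

lemma summable_pow_mul_one_add_two_mul_rpow (τ : ℝ) {r : ℝ} (hr0 : 0 < r) (hr1 : r < 1) :
    Summable fun m : ℕ => r ^ m * ((1 : ℝ) + 2 * (m : ℝ)) ^ τ := by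
  have h := (summable_nat_add_iff 1).2 (summable_pow_mul_geometric_of_norm_lt_one (R := ℝ) ⌈τ⌉₊
    (r := r) (by rwa [Real.norm_of_nonneg hr0.le]))
  refine Summable.of_nonneg_of_le (fun m => by positivity) (fun m => ?_)
    (h.mul_left (2 ^ ⌈τ⌉₊ * r⁻¹))
  calc r ^ m * ((1 : ℝ) + 2 * (m : ℝ)) ^ τ
      ≤ r ^ m * ((1 : ℝ) + 2 * (m : ℝ)) ^ (⌈τ⌉₊ : ℝ) := by
        gcongr
        · linarith [(Nat.cast_nonneg m : (0 : ℝ) ≤ m)]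
        · exact Nat.le_ceil τ
    _ = r ^ m * ((1 : ℝ) + 2 * (m : ℝ)) ^ ⌈τ⌉₊ := by rw [Real.rpow_natCast]
    _ ≤ r ^ m * (2 * ((m + 1 : ℕ) : ℝ)) ^ ⌈τ⌉₊ := by
        gcongr
        push_cast
        linarith
    _ = _ := by
        rw [mul_pow]
        field_simp
        ring

lemma sum_weightedTerm_le_pow_card {ι : Type*} [Fintype ι] [DecidableEq ι] {τ p δ : ℝ}
    (hp : 0 < p) (hδ0 : 0 < δ) (hδ1 : δ < 1) {a : ι → ℝ} (ha : ∀ i, 0 ≤ a i) (hδ : ∑ i, a i ≤ δ)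
    (N : ℕ) :
    ∑ ν ∈ Fintype.piFinset fun _ : ι => range N, weightedTerm τ p a ν
      ≤ (∑' m : ℕ, (δ ^ p) ^ m * ((1 : ℝ) + 2 * (m : ℝ)) ^ τ) ^ Fintype.card ι := by
  have hsum := summable_pow_mul_one_add_two_mul_rpow τ (Real.rpow_pos_of_pos hδ0 p)
    (Real.rpow_lt_one hδ0.le hδ1 hp)
  calc ∑ ν ∈ Fintype.piFinset fun _ : ι => range N, weightedTerm τ p a ν
      ≤ ∑ ν ∈ Fintype.piFinset fun _ : ι => range N,
          ∏ i, (δ ^ p) ^ ν i * ((1 : ℝ) + 2 * (ν i : ℝ)) ^ τ := by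
        refine Finset.sum_le_sum fun ν _ => ?_
        have h0 : 0 ≤ selfPowCoeff ν * ∏ j, a j ^ ν j := mul_nonneg (selfPowCoeff_nonneg ν)
          (Finset.prod_nonneg fun i _ => pow_nonneg (ha i) _)
        have h1 := (selfPowCoeff_mul_prod_le ha ν).trans
          (pow_le_pow_left₀ (Finset.sum_nonneg fun i _ => ha i) hδ _)
        have h2 := Real.rpow_le_rpow h0 h1 hp.le
        rw [Finset.prod_mul_distrib, Finset.prod_pow_eq_pow_sum, ← Real.rpow_natCast,
          ← Real.rpow_mul hδ0.le, mul_comm p, Real.rpow_mul hδ0.le, Real.rpow_natCast]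
        exact mul_le_mul_of_nonneg_right h2 (by positivity)
    _ = ∏ _i : ι, ∑ m ∈ range N, (δ ^ p) ^ m * ((1 : ℝ) + 2 * (m : ℝ)) ^ τ :=
        Finset.sum_prod_piFinset (range N)
          fun _ m => (δ ^ p) ^ m * ((1 : ℝ) + 2 * (m : ℝ)) ^ τ
    _ = (∑ m ∈ range N, (δ ^ p) ^ m * ((1 : ℝ) + 2 * (m : ℝ)) ^ τ) ^ Fintype.card ι := by
        rw [Finset.prod_const, Finset.card_univ]
    _ ≤ _ := pow_le_pow_left₀ (Finset.sum_nonneg fun m _ => by positivity)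
        (hsum.sum_le_tsum _ fun m _ => by positivity) _

lemma selfPowCoeff_le_multinomial {ι : Type*} [Fintype ι] (ν : ι → ℕ) :
    selfPowCoeff ν ≤ Nat.multinomial univ ν * ∏ j, Real.exp 1 ^ ν j := by
  have h1 : ((∑ j, ν j : ℕ) : ℝ) ^ (∑ j, ν j) ≤ (∑ j, ν j).factorial * Real.exp 1 ^ ∑ j, ν j := by
    have := Real.pow_div_factorial_le_exp ((∑ j, ν j : ℕ) : ℝ) (Nat.cast_nonneg _) (∑ j, ν j)
    rw [div_le_iff₀ (by positivity)] at this
    rwa [← Real.exp_nat_mul, mul_one, mul_comm]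
  have h2 : ∏ j, ((ν j).factorial : ℝ) ≤ ∏ j, ((ν j : ℝ) ^ ν j) :=
    Finset.prod_le_prod (fun _ _ => by positivity) fun i _ => by
      exact_mod_cast Nat.factorial_le_pow (ν i)
  have h3 : (∏ j, ((ν j).factorial : ℝ)) * Nat.multinomial univ ν = (∑ j, ν j).factorial := by
    exact_mod_cast Nat.multinomial_spec univ ν
  unfold selfPowCoeff
  rw [div_le_iff₀ (prod_self_pow_pos ν), Finset.prod_pow_eq_pow_sum]
  refine h1.trans ?_
  rw [← h3]
  calc _ ≤ (∏ j, ((ν j : ℝ) ^ ν j)) * Nat.multinomial univ ν * Real.exp 1 ^ ∑ j, ν j := by gcongr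
    _ = _ := by ring

lemma sum_multinomial_mul_prod_le {ι : Type*} [Fintype ι] [DecidableEq ι] {c : ι → ℝ}
    (hc : ∀ i, 0 ≤ c i) (hc1 : ∑ i, c i ≤ 1 / 2) (N : ℕ) :
    ∑ ν ∈ Fintype.piFinset fun _ : ι => range N,
      (Nat.multinomial univ ν : ℝ) * ∏ i, c i ^ ν i ≤ 2 := by
  set P := Fintype.piFinset fun _ : ι => range N
  set L := P.sup (fun ν => ∑ i, ν i) + 1
  have hterm : ∀ ν : ι → ℕ, 0 ≤ (Nat.multinomial univ ν : ℝ) * ∏ i, c i ^ ν i := fun ν =>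
    mul_nonneg (Nat.cast_nonneg _) (Finset.prod_nonneg fun i _ => pow_nonneg (hc i) _)
  have hmaps : ∀ ν ∈ P, ∑ i, ν i ∈ range L := fun ν hν =>
    Finset.mem_range.2 (Nat.lt_succ_of_le (Finset.le_sup (f := fun ν : ι → ℕ => ∑ i, ν i) hν))
  rw [← Finset.sum_fiberwise_of_maps_to hmaps]
  calc _ ≤ ∑ l ∈ range L, (∑ i, c i) ^ l := by
        refine Finset.sum_le_sum fun l _ => ?_
        rw [Finset.sum_pow_eq_sum_piAntidiag]
        refine Finset.sum_le_sum_of_subset_of_nonneg (fun ν hν => ?_) fun ν _ _ => hterm ν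
        simpa using (Finset.mem_filter.1 hν).2
    _ ≤ ∑ l ∈ range L, (1 / 2 : ℝ) ^ l := by
        gcongr with l _
        exact Finset.sum_nonneg fun i _ => hc i
    _ ≤ 2 := sum_geometric_two_le L

lemma sum_weightedTerm_le_two {ι : Type*} [Fintype ι] [DecidableEq ι] {τ p : ℝ} (hτ : 0 ≤ τ)
    (hp : 0 < p) (hp1 : p ≤ 1) {a : ι → ℝ} (ha : ∀ i, 0 ≤ a i)
    (hsmall : ∑ i, (Real.exp 1 * a i) ^ p * Real.exp (2 * τ) ≤ 1 / 2) (N : ℕ) :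
    ∑ ν ∈ Fintype.piFinset fun _ : ι => range N, weightedTerm τ p a ν ≤ 2 := by
  have hea : ∀ i, 0 ≤ Real.exp 1 * a i := fun i => mul_nonneg (Real.exp_pos _).le (ha i)
  refine (Finset.sum_le_sum fun ν _ => ?_).trans
    (sum_multinomial_mul_prod_le (fun i => by have := hea i; positivity) hsmall N)
  have hA : 0 ≤ ∏ j, a j ^ ν j := Finset.prod_nonneg fun i _ => pow_nonneg (ha i) _
  have hB : 0 ≤ ∏ j, (Real.exp 1 * a j) ^ ν j := Finset.prod_nonneg fun i _ => pow_nonneg (hea i) _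
  have hC := selfPowCoeff_nonneg ν
  have h1 : selfPowCoeff ν * ∏ j, a j ^ ν j ≤
      Nat.multinomial univ ν * ∏ j, (Real.exp 1 * a j) ^ ν j := by
    simp only [mul_pow, Finset.prod_mul_distrib]
    rw [← mul_assoc]
    exact mul_le_mul_of_nonneg_right (selfPowCoeff_le_multinomial ν) hA
  have hmult : (1 : ℝ) ≤ Nat.multinomial univ ν := by exact_mod_cast Nat.multinomial_pos univ ν
  have h2 : (selfPowCoeff ν * ∏ j, a j ^ ν j) ^ p ≤
      Nat.multinomial univ ν * ∏ j, ((Real.exp 1 * a j) ^ p) ^ ν j := by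
    refine (Real.rpow_le_rpow (by positivity) h1 hp.le).trans ?_
    rw [Real.mul_rpow (by positivity) hB]
    rw [← Real.finsetProd_rpow _ _ fun i _ => pow_nonneg (hea i) _]
    simp only [Real.rpow_pow_comm (hea _)]
    refine mul_le_mul_of_nonneg_right ?_ (Finset.prod_nonneg fun i _ => ?_)
    · exact Real.rpow_le_self_of_one_le hmult hp1
    · have := hea i
      positivity
  have h3 : ∏ j, ((1 : ℝ) + 2 * (ν j : ℝ)) ^ τ ≤ ∏ j, Real.exp (2 * τ) ^ ν j := by
    refine Finset.prod_le_prod (fun _ _ => by positivity) fun i _ => ?_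
    have : ((1 : ℝ) + 2 * (ν i : ℝ)) ^ τ ≤ Real.exp (2 * ν i) ^ τ := by
      gcongr
      linarith [Real.add_one_le_exp (2 * (ν i : ℝ))]
    rwa [← Real.exp_mul, mul_right_comm, mul_comm (2 * τ), Real.exp_nat_mul] at this
  simp only [mul_pow _ (Real.exp (2 * τ)), Finset.prod_mul_distrib]
  rw [← mul_assoc]
  refine mul_le_mul h2 h3 (by positivity) ?_
  exact mul_nonneg (by positivity) (Finset.prod_nonneg fun i _ => by have := hea i; positivity)

lemma sum_comp_le_tsum_of_injective {ι : Type*} [Fintype ι] {f : ℕ → ℝ} (hf : ∀ j, 0 ≤ f j)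
    (hs : Summable f) {g : ι → ℕ} (hg : Function.Injective g) : ∑ i, f (g i) ≤ ∑' j, f j := by
  classical
  rw [← Finset.sum_image (s := univ) (f := f) fun x _ y _ h => hg h]
  exact hs.sum_le_tsum _ fun j _ => hf j

lemma exists_sum_weightedTerm_le {τ p : ℝ} (hτ : 0 ≤ τ) (hp : 0 < p) (hp1 : p ≤ 1) {a : ℕ → ℝ}
    (ha : ∀ j, 0 < a j) (hs : Summable a) (hlp : Summable fun j => a j ^ p)
    (hsum : ∑' j, a j < 1) :
    ∃ C : ℝ, ∀ n N : ℕ, ∑ ν ∈ Fintype.piFinset fun _ : Fin n => range N,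
      weightedTerm τ p (fun i : Fin n => a i) ν ≤ C := by
  have hα : 0 < ∑' j, a j := hs.tsum_pos (fun j => (ha j).le) 0 (ha 0)
  obtain ⟨s, hs1, hs2⟩ := exists_between hsum
  have hs0 : 0 < s := hα.trans hs1
  have ht : 0 < 1 - s := by linarith
  set δ := (∑' j, a j) / s
  have hδ0 : 0 < δ := by positivity
  have hδ1 : δ < 1 := (div_lt_one hs0).2 hs1
  set M := ∑' m : ℕ, (δ ^ p) ^ m * ((1 : ℝ) + 2 * (m : ℝ)) ^ τ
  have hM : 1 ≤ M := by
    have := (summable_pow_mul_one_add_two_mul_rpow τ (Real.rpow_pos_of_pos hδ0 p)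
      (Real.rpow_lt_one hδ0.le hδ1 hp)).le_tsum 0 fun m _ => by positivity
    simpa using this
  have hlp' : Summable fun j => (Real.exp 1 * (a j / (1 - s))) ^ p * Real.exp (2 * τ) := by
    have : ∀ j, (Real.exp 1 * (a j / (1 - s))) ^ p * Real.exp (2 * τ) =
        a j ^ p * ((Real.exp 1 / (1 - s)) ^ p * Real.exp (2 * τ)) := fun j => by
      rw [← mul_assoc, ← Real.mul_rpow (ha j).le (by positivity)]
      congr 2
      ring
    simp only [this]
    exact hlp.mul_right _
  obtain ⟨S, hS⟩ := summable_iff_vanishing_norm.1 hlp' (1 / 2) (by norm_num)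
  refine ⟨M ^ S.card * 2, fun n N => ?_⟩
  let q : Fin n → Prop := fun i => (i : ℕ) ∈ S
  have hhead : ∑ ν ∈ Fintype.piFinset fun _ : {i // q i} => range N,
      weightedTerm τ p (fun i : {i // q i} => a i / s) ν ≤ M ^ S.card := by
    refine (sum_weightedTerm_le_pow_card (a := fun i : {i // q i} => a i / s) hp hδ0 hδ1
      (fun i => (div_pos (ha i) hs0).le) ?_ N).trans
      (pow_le_pow_right₀ hM ?_)
    · rw [← Finset.sum_div]
      exact div_le_div_of_nonneg_right (sum_comp_le_tsum_of_injective (fun j => (ha j).le) hs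
        (g := fun i : {i // q i} => ((i : Fin n) : ℕ))
        (Fin.val_injective.comp Subtype.val_injective)) hs0.le
    · rw [← Fintype.card_coe S]
      exact Fintype.card_le_of_injective (fun i : {i // q i} => (⟨i, i.2⟩ : S))
        fun x y h => Subtype.ext (Fin.ext (congrArg Subtype.val h))
  have htail : ∑ ν ∈ Fintype.piFinset fun _ : {i // ¬ q i} => range N,
      weightedTerm τ p (fun i : {i // ¬ q i} => a i / (1 - s)) ν ≤ 2 := by
    refine sum_weightedTerm_le_two (a := fun i : {i // ¬ q i} => a i / (1 - s)) hτ hp hp1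
      (fun i => (div_pos (ha i) ht).le) ?_ N
    have hinj : Function.Injective fun i : {i // ¬ q i} => ((i : Fin n) : ℕ) :=
      Fin.val_injective.comp Subtype.val_injective
    have := hS (univ.image fun i : {i // ¬ q i} => ((i : Fin n) : ℕ)) (by
      rw [Finset.disjoint_left]
      intro j hj
      obtain ⟨i, -, rfl⟩ := Finset.mem_image.1 hj
      exact i.2)
    rw [Finset.sum_image fun x _ y _ h => hinj h] at this
    exact (le_abs_self _).trans this.le
  calc _ ≤ ∑ ν ∈ Fintype.piFinset fun _ : Fin n => range N,
        weightedTerm τ p (fun i : {i // q i} => a i / s) (fun i => ν i) *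
        weightedTerm τ p (fun i : {i // ¬ q i} => a i / (1 - s)) (fun i => ν i) :=
        Finset.sum_le_sum fun ν _ =>
          weightedTerm_le_mul (a := fun i : Fin n => a i) q hp.le (fun i => (ha i).le) hs0 ht (by ring) ν
    _ = ∑ x ∈ (Fintype.piFinset fun _ : {i // q i} => range N) ×ˢ
          (Fintype.piFinset fun _ : {i // ¬ q i} => range N),
        weightedTerm τ p (fun i : {i // q i} => a i / s) x.1 *
        weightedTerm τ p (fun i : {i // ¬ q i} => a i / (1 - s)) x.2 := by
        refine Finset.sum_equiv (Equiv.piEquivPiSubtypeProd q fun _ => ℕ) (fun ν => ?_)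
          fun ν _ => rfl
        simp only [Finset.mem_product, Fintype.mem_piFinset, Equiv.piEquivPiSubtypeProd_apply,
          Subtype.forall]
        exact ⟨fun h => ⟨fun i _ => h i, fun i _ => h i⟩,
          fun h i => (em (q i)).elim (h.1 i) (h.2 i)⟩
    _ = (∑ ν ∈ Fintype.piFinset fun _ : {i // q i} => range N,
          weightedTerm τ p (fun i : {i // q i} => a i / s) ν) *
        ∑ ν ∈ Fintype.piFinset fun _ : {i // ¬ q i} => range N,
          weightedTerm τ p (fun i : {i // ¬ q i} => a i / (1 - s)) ν := by
        rw [Finset.sum_mul_sum, Finset.sum_product]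
    _ ≤ M ^ S.card * 2 := mul_le_mul hhead htail
        (Finset.sum_nonneg fun ν _ => weightedTerm_nonneg
          (a := fun i : {i // ¬ q i} => a i / (1 - s)) _ _ (fun i => (div_pos (ha i) ht).le) ν)
        (by positivity)

lemma weightedTerm_snoc_zero {τ p : ℝ} (a : ℕ → ℝ) {k : ℕ} (ν : Fin k → ℕ) :
    weightedTerm τ p (fun i : Fin (k + 1) => a i) (Fin.snoc ν 0 : Fin (k + 1) → ℕ) =
      weightedTerm τ p (fun i : Fin k => a i) ν := by
  simp [weightedTerm, selfPowCoeff, Fin.sum_univ_castSucc, Fin.prod_univ_castSucc]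

lemma sum_filter_last_eq_zero {τ p : ℝ} (a : ℕ → ℝ) (k N : ℕ) :
    ∑ ν ∈ Fintype.piFinset (fun _ : Fin (k + 1) => range (N + 1)) with ν (Fin.last k) = 0,
      weightedTerm τ p (fun i : Fin (k + 1) => a i) ν =
    ∑ ν ∈ Fintype.piFinset fun _ : Fin k => range (N + 1),
      weightedTerm τ p (fun i : Fin k => a i) ν := by
  refine (Finset.sum_nbij' (fun ν => (Fin.snoc ν 0 : Fin (k + 1) → ℕ)) (fun ν i => ν i.castSucc)
    ?_ ?_ ?_ ?_ ?_).symm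
  · intro ν hν
    simp only [Fintype.mem_piFinset, Finset.mem_filter, Fin.forall_fin_succ'] at hν ⊢
    simpa using hν
  · intro ν hν
    simp only [Fintype.mem_piFinset, Finset.mem_filter] at hν ⊢
    exact fun i => hν.1 _
  · intro ν _
    simp
  · intro ν hν
    have h := (Finset.mem_filter.1 hν).2
    ext i
    refine Fin.lastCases ?_ (fun j => ?_) i
    · simp [h]
    · simp
  · exact fun ν _ => (weightedTerm_snoc_zero a ν).symm

lemma gamma_term_eq {τ p : ℝ} {ϱ : ℕ → ℝ} (hϱ : ∀ j, 1 < ϱ j) {k : ℕ} (ν : Fin (k + 1) → ℕ) :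
    (combFactor ν * gamma ϱ ν) ^ p * ∏ j, ((1 : ℝ) + 2 * (ν j : ℝ)) ^ τ =
      if ν (Fin.last k) = 0 then
        ((ϱ k)⁻¹) ^ p * weightedTerm τ p (fun i : Fin (k + 1) => (ϱ i)⁻¹) ν
      else weightedTerm τ p (fun i : Fin (k + 1) => (ϱ i)⁻¹) ν := by
  have hpos : ∀ j, 0 < (ϱ j)⁻¹ := fun j => inv_pos.2 (zero_lt_one.trans (hϱ j))
  have hcomb : combFactor ν = selfPowCoeff ν := rfl
  have hC := selfPowCoeff_nonneg ν
  have hA : 0 ≤ ∏ j : Fin k, (ϱ j)⁻¹ ^ ν j.castSucc :=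
    Finset.prod_nonneg fun j _ => pow_nonneg (hpos j).le _
  unfold weightedTerm gamma
  rw [hcomb, Fin.prod_univ_castSucc (f := fun j : Fin (k + 1) => (ϱ j)⁻¹ ^ ν j)]
  simp only [Fin.val_castSucc, Fin.val_last]
  split_ifs with h
  · simp only [h, pow_zero, mul_one, zero_le, sup_of_le_left, pow_one]
    rw [mul_left_comm, Real.mul_rpow (hpos k).le (mul_nonneg hC hA), mul_assoc]
  · rw [max_eq_right (Nat.one_le_iff_ne_zero.2 h)]
    rw [mul_comm (∏ j : Fin k, _)]

/-- Lemma `lemma:Sxi`.  Let `τ > 0` and `ϱ ∈ (1,∞)^ℕ` with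
`(ϱ_j^{-1}) ∈ ℓ^p(ℕ)` for some `p ∈ (0,1]` and `∑_j ϱ_j^{-1} < 1`.  Then
`∑_{k∈ℕ} ∑_{ν∈ℕ₀^k} ((|ν|^{|ν|}/ν^ν) γ(ϱ,ν))^p ∏_{j=1}^k (1+2ν_j)^τ < ∞`. -/
theorem summable_gamma_pow_combinatorial
    (τ : ℝ) (hτ : 0 < τ) (ϱ : ℕ → ℝ) (hϱ : ∀ j, 1 < ϱ j)
    (p : ℝ) (hp0 : 0 < p) (hp1 : p ≤ 1)
    (hlp : Summable fun j => ((ϱ j)⁻¹) ^ p)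
    (hsum : (∑' j : ℕ, (ϱ j)⁻¹) < 1) :
    Summable fun q : Σ k : ℕ, (Fin (k + 1) → ℕ) =>
      (combFactor q.2 * gamma ϱ q.2) ^ p * ∏ j, ((1 : ℝ) + 2 * (q.2 j : ℝ)) ^ τ := by
  set a : ℕ → ℝ := fun j => (ϱ j)⁻¹ with ha_def
  have ha : ∀ j, 0 < a j := fun j => inv_pos.2 (zero_lt_one.trans (hϱ j))
  have hs : Summable a := Summable.of_nonneg_of_le (fun j => (ha j).le)
    (fun j => Real.self_le_rpow_of_le_one (ha j).le (inv_le_one_of_one_le₀ (hϱ j).le) hp1) hlp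
  obtain ⟨C, hC⟩ := exists_sum_weightedTerm_le hτ.le hp0 hp1 ha hs hlp hsum
  set F : (Σ k : ℕ, (Fin (k + 1) → ℕ)) → ℝ := fun q =>
    (combFactor q.2 * gamma ϱ q.2) ^ p * ∏ j, ((1 : ℝ) + 2 * (q.2 j : ℝ)) ^ τ with hF
  have hW : ∀ {n : ℕ} (ν : Fin n → ℕ), 0 ≤ weightedTerm τ p (fun i : Fin n => a i) ν :=
    fun {n} ν => weightedTerm_nonneg (a := fun i : Fin n => a i) _ _ (fun i => (ha i).le) ν
  have hF0 : ∀ q, 0 ≤ F q := fun q => by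
    have h1 := hW q.2
    have h2 := (Real.rpow_pos_of_pos (ha q.1) p).le
    simp only [hF, gamma_term_eq hϱ]
    split_ifs
    exacts [mul_nonneg h2 h1, h1]
  let U : ℕ → ℕ → ℝ := fun N n => ∑ ν ∈ Fintype.piFinset fun _ : Fin n => range (N + 1),
    weightedTerm τ p (fun i : Fin n => a i) ν
  have hU0 : ∀ N n, 0 ≤ U N n := fun N n => Finset.sum_nonneg fun ν _ => hW ν
  have hlevel : ∀ N k, ∑ ν ∈ Fintype.piFinset fun _ : Fin (k + 1) => range (N + 1), F ⟨k, ν⟩ =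
      a k ^ p * U N k + (U N (k + 1) - U N k) := fun N k => by
    have h1 := sum_filter_last_eq_zero (τ := τ) (p := p) a k N
    have h2 := Finset.sum_filter_add_sum_filter_not
      (Fintype.piFinset fun _ : Fin (k + 1) => range (N + 1)) (fun ν => ν (Fin.last k) = 0)
      fun ν => weightedTerm τ p (fun i : Fin (k + 1) => a i) ν
    simp only [hF, gamma_term_eq hϱ]
    rw [Finset.sum_ite, ← Finset.mul_sum]
    change a k ^ p * _ + _ = _
    simp only [U]
    rw [← h1, ← h2]
    ring
  refine summable_of_sum_le (c := (∑' j, a j ^ p) * C + C) hF0 fun u => ?_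
  obtain ⟨K, hK⟩ : ∃ K, ∀ q ∈ u, q.1 < K :=
    ⟨u.sup (fun q => q.1) + 1, fun q hq => Nat.lt_succ_of_le (Finset.le_sup (f := fun q => q.1) hq)⟩
  obtain ⟨N, hN⟩ : ∃ N, ∀ q ∈ u, ∀ i, q.2 i < N + 1 :=
    ⟨u.sup fun q => ∑ i, q.2 i, fun q hq i => Nat.lt_succ_of_le
      ((Finset.single_le_sum (fun _ _ => Nat.zero_le _) (Finset.mem_univ i)).trans
        (Finset.le_sup (f := fun q : Σ k : ℕ, (Fin (k + 1) → ℕ) => ∑ i, q.2 i) hq))⟩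
  have hC0 : 0 ≤ C := (hU0 0 0).trans (hC 0 1)
  calc ∑ q ∈ u, F q
      ≤ ∑ q ∈ (range K).sigma fun k => Fintype.piFinset fun _ : Fin (k + 1) => range (N + 1),
          F q := by
        refine Finset.sum_le_sum_of_subset_of_nonneg (fun q hq => ?_) fun q _ _ => hF0 q
        simp only [Finset.mem_sigma, Finset.mem_range, Fintype.mem_piFinset]
        exact ⟨hK q hq, hN q hq⟩
    _ = ∑ k ∈ range K, a k ^ p * U N k + (U N K - U N 0) := by
        rw [Finset.sum_sigma, ← Finset.sum_range_sub, ← Finset.sum_add_distrib]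
        exact Finset.sum_congr rfl fun k _ => hlevel N k
    _ ≤ ∑ k ∈ range K, a k ^ p * C + C := by
        refine add_le_add (Finset.sum_le_sum fun k _ => mul_le_mul_of_nonneg_left (hC k (N + 1))
          (Real.rpow_pos_of_pos (ha k) p).le) ?_
        linarith [hC K (N + 1), hU0 N 0]
    _ ≤ (∑' j, a j ^ p) * C + C := by
        rw [← Finset.sum_mul]
        gcongr
        exact hlp.sum_le_tsum _ fun j _ => (Real.rpow_pos_of_pos (ha j) p).le

end SparseTransport
end
end
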